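/- Let q̃_1, …, q̃_{r−1} be pairwise distinct integers such that each q̃_i ≡ 1 (mod 4) and each |q̃_i| is an odd prime, and let q̃_r = 8 or q̃_r = −8. In ℂ set α_i = (1 + √q̃_i)/2 and ᾱ_i = (1 − √q̃_i)/2 for i < r, and α_r = √(q̃_r/4) (i.e. √2 or i√2). Let M = ℚ(√q̃_1, …, √q̃_r) ⊂ ℂ. Then: (1) the 2^r products α_1^{s_1}⋯α_r^{s_r}, for s ∈ {0,1}^r, form a ℤ-basis of the ring of integers 𝓞_M; (2) the 2^r products ᾱ_1^{s_1}·α_1^{1−s_1}⋯ᾱ_{r−1}^{s_{r−1}}·α_{r−1}^{1−s_{r−1}}·α_r^{s_r}, for s ∈ {0,1}^r, also form a ℤ-basis of 𝓞_M. -/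

import Mathlib

/-- The square root of a real number inside `ℂ`: for a negative real `x`,
`√x` denotes `i·√|x|`. -/
noncomputable def csqrt (x : ℝ) : ℂ :=
  if x < 0 then Complex.I * Real.sqrt (-x) else Real.sqrt x

/-- A family `e` of complex numbers is a `ℤ`-basis of the ring of integers
`𝓞_M = integralClosure ℤ M` of a subfield `M ⊂ ℂ`. -/
def IsIntBasis {ι : Type*} (M : IntermediateField ℚ ℂ) (e : ι → ℂ) : Prop :=
  (∀ s, e s ∈ M) ∧ (∀ s, IsIntegral ℤ (e s)) ∧ LinearIndependent ℤ e ∧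
    ∀ x : ℂ, x ∈ M → IsIntegral ℤ x → x ∈ Submodule.span ℤ (Set.range e)

/-- `p` is "unramified" in `K`: an element of `K` whose square is divisible by `p` in the ring of
integers is itself divisible by `p`. -/
def SqDvdImpDvd (K : IntermediateField ℚ ℂ) (p : ℤ) : Prop :=
  ∀ w ∈ K, IsIntegral ℤ (w ^ 2 / p) → IsIntegral ℤ (w / p)

lemma isIntegral_of_sq {x : ℂ} (h : IsIntegral ℤ (x ^ 2)) : IsIntegral ℤ x :=
  IsIntegral.of_pow (n := 2) (by norm_num) h

lemma isIntegral_of_eq {x y : ℂ} (h : IsIntegral ℤ x) (e : y = x) : IsIntegral ℤ y :=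
  e ▸ h

lemma isIntegral_int (n : ℤ) : IsIntegral ℤ (n : ℂ) := by
  simpa using isIntegral_algebraMap (R := ℤ) (A := ℂ) (x := n)

lemma exists_int_of_isIntegral {x : ℂ} (hx : x ∈ (⊥ : IntermediateField ℚ ℂ))
    (h : IsIntegral ℤ x) : ∃ n : ℤ, x = n := by
  obtain ⟨r, rfl⟩ := IntermediateField.mem_bot.1 hx
  have h1 : IsIntegral ℤ r :=
    (isIntegral_algebraMap_iff (FaithfulSMul.algebraMap_injective ℚ ℂ)).1 h
  obtain ⟨n, rfl⟩ := IsIntegrallyClosed.isIntegral_iff.1 h1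
  exact ⟨n, by simp⟩

lemma not_isIntegral_inv {p : ℤ} (hp : Prime p) : ¬ IsIntegral ℤ (1 / (p : ℂ)) := by
  intro h
  have hp0 : (p : ℂ) ≠ 0 := by exact_mod_cast hp.ne_zero
  obtain ⟨n, hn⟩ := exists_int_of_isIntegral
    (div_mem (one_mem _) (intCast_mem _ p)) h
  rw [div_eq_iff hp0] at hn
  exact hp.not_isUnit (IsUnit.of_mul_eq_one n (by rw [mul_comm]; exact_mod_cast hn.symm))

lemma sqDvdImpDvd_bot {p : ℤ} (hp : Prime p) : SqDvdImpDvd ⊥ p := by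
  intro w hw h
  have hp0 : (p : ℂ) ≠ 0 := by exact_mod_cast hp.ne_zero
  have hwi : IsIntegral ℤ w := by
    apply isIntegral_of_sq
    have := h.mul (isIntegral_int p)
    rwa [div_mul_cancel₀ _ hp0] at this
  obtain ⟨n, rfl⟩ := exists_int_of_isIntegral hw hwi
  obtain ⟨m, hm⟩ := exists_int_of_isIntegral
    (div_mem (pow_mem hw 2) (intCast_mem _ p)) h
  rw [div_eq_iff hp0] at hm
  have h2 : p ∣ n ^ 2 := ⟨m, by rw [mul_comm]; exact_mod_cast hm⟩
  obtain ⟨k, rfl⟩ := hp.dvd_of_dvd_pow h2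
  rw [Int.cast_mul, mul_div_cancel_left₀ _ hp0]
  exact isIntegral_int k

lemma isIntegral_of_isCoprime {x : ℂ} {m n : ℤ} (hmn : IsCoprime m n)
    (hm : IsIntegral ℤ (m * x)) (hn : IsIntegral ℤ (n * x)) : IsIntegral ℤ x := by
  obtain ⟨s, t, hst⟩ := hmn
  have h : x = s * (m * x) + t * (n * x) := by
    have : (s * m + t * n : ℂ) = 1 := by exact_mod_cast hst
    linear_combination (-x) * this
  rw [h]
  exact ((isIntegral_int s).mul hm).add ((isIntegral_int t).mul hn)

section Quadratic

variable {K : IntermediateField ℚ ℂ} {a : ℂ} {d : ℤ}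

lemma eq_zero_of_add_mul_eq_zero (ha : a ∉ K) {u v : ℂ} (hu : u ∈ K) (hv : v ∈ K)
    (h : u + v * a = 0) : u = 0 ∧ v = 0 := by
  have hv0 : v = 0 := by
    by_contra hv0
    apply ha
    have : a = -u / v := by
      rw [eq_div_iff hv0]
      linear_combination h
    rw [this]
    exact div_mem (neg_mem hu) hv
  refine ⟨?_, hv0⟩
  simpa [hv0] using h

/-- Conjugation of `K(a)` over `K` preserves integrality. -/
lemma isIntegral_conj (ha : a ∉ K) (had : a ^ 2 = d) {u v : ℂ} (hu : u ∈ K) (hv : v ∈ K)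
    (h : IsIntegral ℤ (u + v * a)) : IsIntegral ℤ (u - v * a) := by
  have key : ∀ p : Polynomial ℤ, ∃ A ∈ K, ∃ B ∈ K,
      Polynomial.aeval (u + v * a) p = A + B * a ∧
      Polynomial.aeval (u - v * a) p = A - B * a := by
    intro p
    induction p using Polynomial.induction_on with
    | C n => exact ⟨n, intCast_mem _ n, 0, zero_mem _, by simp, by simp⟩
    | add p q hp hq =>
      obtain ⟨A, hA, B, hB, h1, h2⟩ := hp
      obtain ⟨A', hA', B', hB', h1', h2'⟩ := hq
      refine ⟨A + A', add_mem hA hA', B + B', add_mem hB hB', ?_, ?_⟩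
      · rw [map_add, h1, h1']; ring
      · rw [map_add, h2, h2']; ring
    | monomial n c hp =>
      obtain ⟨A, hA, B, hB, h1, h2⟩ := hp
      refine ⟨A * u + B * v * d, add_mem (mul_mem hA hu) (mul_mem (mul_mem hB hv)
        (intCast_mem _ d)), A * v + B * u, add_mem (mul_mem hA hv) (mul_mem hB hu), ?_, ?_⟩
      · rw [pow_succ, ← mul_assoc, map_mul, h1, Polynomial.aeval_X]
        linear_combination B * v * had
      · rw [pow_succ, ← mul_assoc, map_mul, h2, Polynomial.aeval_X]
        linear_combination B * v * had
  obtain ⟨p, hp, hp0⟩ := h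
  obtain ⟨A, hA, B, hB, h1, h2⟩ := key p
  rw [← Polynomial.aeval_def, h1] at hp0
  obtain ⟨rfl, rfl⟩ := eq_zero_of_add_mul_eq_zero ha hA hB hp0
  exact ⟨p, hp, by rw [← Polynomial.aeval_def, h2]; simp⟩

lemma isIntegral_sqrt (had : a ^ 2 = d) : IsIntegral ℤ a :=
  isIntegral_of_sq (had ▸ isIntegral_int d)

lemma SqDvdImpDvd.sqrt_notMem (hK : SqDvdImpDvd K d) (hd : Prime d) (had : a ^ 2 = d) :
    a ∉ K := by
  intro ha
  have hd0 : (d : ℂ) ≠ 0 := by exact_mod_cast hd.ne_zero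
  have h1 : IsIntegral ℤ (a / d) := by
    apply hK a ha
    rw [had, div_self hd0]
    exact isIntegral_one
  apply not_isIntegral_inv hd
  have h2 := h1.pow 2
  rwa [div_pow, had, sq, div_mul_eq_div_div, div_self hd0] at h2

lemma SqDvdImpDvd.isIntegral_two_mul (hK : SqDvdImpDvd K d) (hd : d ≠ 0) (had : a ^ 2 = d)
    (ha : a ∉ K) {u v : ℂ} (hu : u ∈ K) (hv : v ∈ K) (h : IsIntegral ℤ (u + v * a)) :
    IsIntegral ℤ (2 * u) ∧ IsIntegral ℤ (2 * v) := by
  have hd0 : (d : ℂ) ≠ 0 := by exact_mod_cast hd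
  have h' := isIntegral_conj ha had hu hv h
  constructor
  · refine isIntegral_of_eq (h.add h') ?_
    ring
  · have h2 : IsIntegral ℤ ((2 * v * d) ^ 2 / d) := by
      refine isIntegral_of_eq ((h.sub h').pow 2) ?_
      rw [div_eq_iff hd0]
      linear_combination (-4 * v ^ 2 * d) * had
    have h3 := hK _ (mul_mem (mul_mem (ofNat_mem K 2) hv) (intCast_mem _ d)) h2
    rwa [mul_div_cancel_right₀ _ hd0] at h3

lemma exists_eq_add_mul_of_mem_adjoin_insert {S : Set ℂ} (hS : ∀ x ∈ S, IsIntegral ℤ x)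
    (had : a ^ 2 = d) {x : ℂ} (hx : x ∈ IntermediateField.adjoin ℚ (insert a S)) :
    ∃ u ∈ IntermediateField.adjoin ℚ S, ∃ v ∈ IntermediateField.adjoin ℚ S, x = u + v * a := by
  have halg : ∀ x ∈ insert a S, IsAlgebraic ℚ x := by
    intro y hy
    have : IsIntegral ℤ y := by
      rcases hy with rfl | hy
      · exact isIntegral_sqrt had
      · exact hS y hy
    exact (this.tower_top (A := ℚ)).isAlgebraic
  rw [← IntermediateField.mem_toSubalgebra,
    IntermediateField.adjoin_toSubalgebra_of_isAlgebraic halg] at hx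
  induction hx using Algebra.adjoin_induction with
  | mem y hy =>
    rcases hy with rfl | hy
    · exact ⟨0, zero_mem _, 1, one_mem _, by simp⟩
    · exact ⟨y, IntermediateField.subset_adjoin _ _ hy, 0, zero_mem _, by simp⟩
  | algebraMap r => exact ⟨_, IntermediateField.algebraMap_mem _ r, 0, zero_mem _, by simp⟩
  | add x y _ _ hx hy =>
    obtain ⟨u, hu, v, hv, rfl⟩ := hx
    obtain ⟨u', hu', v', hv', rfl⟩ := hy
    exact ⟨u + u', add_mem hu hu', v + v', add_mem hv hv', by ring⟩
  | mul x y _ _ hx hy =>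
    obtain ⟨u, hu, v, hv, rfl⟩ := hx
    obtain ⟨u', hu', v', hv', rfl⟩ := hy
    refine ⟨u * u' + v * v' * d, add_mem (mul_mem hu hu') (mul_mem (mul_mem hv hv')
      (intCast_mem _ d)), u * v' + v * u', add_mem (mul_mem hu hv') (mul_mem hv hu'), ?_⟩
    linear_combination v * v' * had

lemma SqDvdImpDvd.adjoin_insert {S : Set ℂ} {p : ℤ} (hS : ∀ x ∈ S, IsIntegral ℤ x)
    (had : a ^ 2 = d) (hp : Prime p) (hpd : IsCoprime (2 * d) p)
    (hK : SqDvdImpDvd (IntermediateField.adjoin ℚ S) p) :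
    SqDvdImpDvd (IntermediateField.adjoin ℚ (insert a S)) p := by
  by_cases ha : a ∈ IntermediateField.adjoin ℚ S
  · have : IntermediateField.adjoin ℚ (insert a S) ≤ IntermediateField.adjoin ℚ S := by
      rw [IntermediateField.adjoin_le_iff, Set.insert_subset_iff]
      exact ⟨ha, IntermediateField.subset_adjoin _ _⟩
    exact fun w hw ↦ hK w (this hw)
  intro w hw h
  have hp0 : (p : ℂ) ≠ 0 := by exact_mod_cast hp.ne_zero
  obtain ⟨u, hu, v, hv, rfl⟩ := exists_eq_add_mul_of_mem_adjoin_insert hS had hw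
  have hwi : IsIntegral ℤ (u + v * a) := by
    apply isIntegral_of_sq
    have := h.mul (isIntegral_int p)
    rwa [div_mul_cancel₀ _ hp0] at this
  have h' : IsIntegral ℤ ((u - v * a) ^ 2 / p) := by
    have e : (u + v * a) ^ 2 / p = (u ^ 2 + v ^ 2 * d) / p + (2 * u * v / p) * a := by
      rw [← had]; ring
    have e' : (u - v * a) ^ 2 / p = (u ^ 2 + v ^ 2 * d) / p - (2 * u * v / p) * a := by
      rw [← had]; ring
    rw [e] at h
    rw [e']
    refine isIntegral_conj ha had ?_ ?_ h
    · exact div_mem (add_mem (pow_mem hu 2) (mul_mem (pow_mem hv 2) (intCast_mem _ d)))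
        (intCast_mem _ p)
    · exact div_mem (mul_mem (mul_mem (ofNat_mem _ 2) hu) hv) (intCast_mem _ p)
  have hN : IsIntegral ℤ ((u + v * a) * (u - v * a) / p) := by
    apply isIntegral_of_sq
    refine isIntegral_of_eq (h.mul h') ?_
    field_simp
  have hu2 : IsIntegral ℤ (2 * u / p) := by
    refine hK _ (mul_mem (ofNat_mem _ 2) hu) ?_
    refine isIntegral_of_eq ((h.add h').add ((isIntegral_int 2).mul hN)) ?_
    push_cast
    ring
  have hv2 : IsIntegral ℤ (2 * v * d / p) := by
    refine hK _ (mul_mem (mul_mem (ofNat_mem _ 2) hv) (intCast_mem _ d)) ?_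
    refine isIntegral_of_eq ((isIntegral_int d).mul
      ((h.add h').sub ((isIntegral_int 2).mul hN))) ?_
    push_cast
    field_simp
    linear_combination (-4 * v ^ 2 * d) * had
  refine isIntegral_of_isCoprime hpd ?_ ?_
  · refine isIntegral_of_eq (((isIntegral_int d).mul hu2).add (hv2.mul (isIntegral_sqrt had))) ?_
    push_cast
    ring
  · rwa [mul_div_cancel₀ _ hp0]

end Quadratic

lemma Fin.range_eq_insert {α : Type*} {n : ℕ} (b : Fin (n + 1) → α) :
    Set.range b = insert (b 0) (Set.range fun i : Fin n ↦ b i.succ) := by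
  ext x
  simp [Fin.exists_fin_succ, eq_comm]

lemma sqDvdImpDvd_adjoin_range {p : ℤ} (hp : Prime p) (n : ℕ) (b : Fin n → ℂ) (d : Fin n → ℤ)
    (hbd : ∀ i, b i ^ 2 = d i) (hpd : ∀ i, IsCoprime (2 * d i) p) :
    SqDvdImpDvd (IntermediateField.adjoin ℚ (Set.range b)) p := by
  induction n with
  | zero =>
    rw [Set.range_eq_empty, IntermediateField.adjoin_empty]
    exact sqDvdImpDvd_bot hp
  | succ n ih =>
    rw [Fin.range_eq_insert]
    refine SqDvdImpDvd.adjoin_insert ?_ (hbd 0) hp (hpd 0)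
      (ih _ (fun i ↦ d i.succ) (fun i ↦ hbd _) fun i ↦ hpd _)
    rintro _ ⟨i, rfl⟩
    exact isIntegral_sqrt (hbd _)

/-- `f` is a relative integral basis of `L / K`. -/
structure IsRelIntBasis (K L : IntermediateField ℚ ℂ) (f : Fin 2 → ℂ) : Prop where
  le : K ≤ L
  mem : ∀ t, f t ∈ L
  isIntegral : ∀ t, IsIntegral ℤ (f t)
  eq_zero : ∀ u ∈ K, ∀ v ∈ K, f 0 * u + f 1 * v = 0 → u = 0 ∧ v = 0
  exists_eq : ∀ x ∈ L, IsIntegral ℤ x → ∃ u ∈ K, ∃ v ∈ K,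
    IsIntegral ℤ u ∧ IsIntegral ℤ v ∧ x = f 0 * u + f 1 * v

lemma IsRelIntBasis.isIntBasis {K L : IntermediateField ℚ ℂ} {f : Fin 2 → ℂ}
    (hf : IsRelIntBasis K L f) {ι : Type*} [Fintype ι] {e : ι → ℂ} (he : IsIntBasis K e) :
    IsIntBasis L fun p : Fin 2 × ι ↦ f p.1 * e p.2 := by
  obtain ⟨hmem, hint, hli, hspan⟩ := he
  refine ⟨fun p ↦ mul_mem (hf.mem _) (hf.le (hmem _)), fun p ↦ (hf.isIntegral _).mul (hint _),
    ?_, ?_⟩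
  · rw [Fintype.linearIndependent_iff] at hli ⊢
    intro g hg
    have hK : ∀ t, ∑ i, g (t, i) • e i ∈ K := fun t ↦
      sum_mem fun i _ ↦ zsmul_mem (hmem i) _
    have h0 : f 0 * ∑ i, g (0, i) • e i + f 1 * ∑ i, g (1, i) • e i = 0 := by
      rw [← hg, Fintype.sum_prod_type, Fin.sum_univ_two, Finset.mul_sum, Finset.mul_sum]
      simp only [mul_smul_comm]
    obtain ⟨h1, h2⟩ := hf.eq_zero _ (hK 0) _ (hK 1) h0
    rintro ⟨t, i⟩
    fin_cases t
    · exact hli _ h1 i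
    · exact hli _ h2 i
  · intro x hx hxi
    obtain ⟨u, hu, v, hv, hui, hvi, rfl⟩ := hf.exists_eq x hx hxi
    have key : ∀ t, ∀ y ∈ Submodule.span ℤ (Set.range e), f t * y ∈
        Submodule.span ℤ (Set.range fun p : Fin 2 × ι ↦ f p.1 * e p.2) := by
      intro t y hy
      induction hy using Submodule.span_induction with
      | mem y hy =>
        obtain ⟨i, rfl⟩ := hy
        exact Submodule.subset_span ⟨(t, i), rfl⟩
      | zero => simp
      | add y z _ _ hy hz => rw [mul_add]; exact add_mem hy hz
      | smul c y _ hy => rw [mul_smul_comm]; exact Submodule.smul_mem _ c hy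
    exact add_mem (key 0 u (hspan u hu hui)) (key 1 v (hspan v hv hvi))

lemma IsIntBasis.comp_equiv {M : IntermediateField ℚ ℂ} {ι κ : Type*} {e : ι → ℂ}
    (he : IsIntBasis M e) (σ : κ ≃ ι) : IsIntBasis M (e ∘ σ) := by
  obtain ⟨h1, h2, h3, h4⟩ := he
  refine ⟨fun s ↦ h1 _, fun s ↦ h2 _, h3.comp _ σ.injective, ?_⟩
  rwa [σ.surjective.range_comp]

lemma isIntBasis_bot {ι : Type*} [Unique ι] : IsIntBasis ⊥ fun _ : ι ↦ (1 : ℂ) := by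
  refine ⟨fun _ ↦ one_mem _, fun _ ↦ isIntegral_one, ?_, ?_⟩
  · rw [linearIndependent_unique_iff]
    exact one_ne_zero
  · intro x hx hxi
    obtain ⟨n, rfl⟩ := exists_int_of_isIntegral hx hxi
    rw [Set.range_const, Submodule.mem_span_singleton]
    exact ⟨n, by simp⟩

/-- The relative integral basis `1, √δ` of `ℚ(√δ)` for `δ = ±2`. -/
lemma isRelIntBasis_sqrt_two {a : ℂ} {d δ : ℤ} (hδ : δ = 2 ∨ δ = -2) (hd : d = 4 * δ)
    (had : a ^ 2 = d) {f : Fin 2 → ℂ} (h0 : f 0 = 1) (h1 : f 1 = a / 2) :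
    IsRelIntBasis ⊥ (IntermediateField.adjoin ℚ (insert a ∅)) f := by
  have haL : a ∈ IntermediateField.adjoin ℚ (insert a ∅) :=
    IntermediateField.subset_adjoin _ _ (Set.mem_insert _ _)
  have hδp : Prime δ := by
    rcases hδ with rfl | rfl <;> norm_num [Int.prime_iff_natAbs_prime]
  have hfd : f 1 ^ 2 = δ := by
    rw [h1, div_pow, had, hd]
    push_cast
    ring
  have hR := sqDvdImpDvd_bot hδp
  have hf1 := hR.sqrt_notMem hδp hfd
  refine ⟨bot_le, ?_, ?_, ?_, ?_⟩
  · rw [Fin.forall_fin_two, h0, h1]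
    exact ⟨one_mem _, div_mem haL (ofNat_mem _ 2)⟩
  · rw [Fin.forall_fin_two, h0]
    exact ⟨isIntegral_one, isIntegral_sqrt hfd⟩
  · intro u hu v hv h
    refine eq_zero_of_add_mul_eq_zero hf1 hu hv ?_
    rw [h0] at h
    linear_combination h
  · intro x hx hxi
    obtain ⟨u, hu, v, hv, rfl⟩ := exists_eq_add_mul_of_mem_adjoin_insert (by simp) had hx
    rw [IntermediateField.adjoin_empty] at hu hv
    have h2v : 2 * v ∈ (⊥ : IntermediateField ℚ ℂ) := mul_mem (ofNat_mem _ 2) hv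
    have hxe : u + v * a = u + 2 * v * f 1 := by rw [h1]; ring
    rw [hxe] at hxi ⊢
    obtain ⟨hA, hB⟩ := hR.isIntegral_two_mul hδp.ne_zero hfd hf1 hu h2v hxi
    obtain ⟨A, hA⟩ := exists_int_of_isIntegral (mul_mem (ofNat_mem _ 2) hu) hA
    obtain ⟨B, hB⟩ := exists_int_of_isIntegral (mul_mem (ofNat_mem _ 2) h2v) hB
    have hNe : (u + 2 * v * f 1) * (u - 2 * v * f 1) = u ^ 2 - δ * (2 * v) ^ 2 := by
      rw [← hfd]; ring
    have hN := hxi.mul (isIntegral_conj hf1 hfd hu h2v hxi)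
    rw [hNe] at hN
    obtain ⟨N, hN⟩ := exists_int_of_isIntegral
      (sub_mem (pow_mem hu 2) (mul_mem (intCast_mem _ δ) (pow_mem h2v 2))) hN
    have hAB : A ^ 2 - δ * B ^ 2 = 4 * N := by
      have : (A ^ 2 - δ * B ^ 2 : ℂ) = 4 * N := by
        rw [← hA, ← hB, ← hN]
        ring
      exact_mod_cast this
    have hA2 : (2 : ℤ) ∣ A := by
      refine Int.prime_two.dvd_of_dvd_pow (n := 2) ?_
      rcases hδ with rfl | rfl
      · exact ⟨B ^ 2 + 2 * N, by linear_combination hAB⟩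
      · exact ⟨-B ^ 2 + 2 * N, by linear_combination hAB⟩
    obtain ⟨A, rfl⟩ := hA2
    have hB2 : (2 : ℤ) ∣ B := by
      refine Int.prime_two.dvd_of_dvd_pow (n := 2) ?_
      rcases hδ with rfl | rfl
      · exact ⟨A ^ 2 - N, by linarith⟩
      · exact ⟨N - A ^ 2, by linarith⟩
    obtain ⟨B, rfl⟩ := hB2
    have hu' : u = A := by
      push_cast at hA
      linear_combination hA / 2
    have hv' : 2 * v = B := by
      push_cast at hB
      linear_combination hB / 2
    refine ⟨u, hu, 2 * v, h2v, ?_, ?_, ?_⟩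
    · exact hu' ▸ isIntegral_int A
    · exact hv' ▸ isIntegral_int B
    · rw [h0]; ring

/-- The relative integral bases `1, α` and `α, ᾱ` of `K(√d) / K`, where `d ≡ 1 mod 4` is a prime
that is unramified in `K` and `α = (1 + √d) / 2`. -/
lemma isRelIntBasis_adjoin_insert {S : Set ℂ} (hS : ∀ x ∈ S, IsIntegral ℤ x) {a : ℂ} {d : ℤ}
    (hd : Prime d) (hd4 : d % 4 = 1) (had : a ^ 2 = d)
    (hR : SqDvdImpDvd (IntermediateField.adjoin ℚ S) d) {f : Fin 2 → ℂ}
    (hf : (f 0 = 1 ∧ f 1 = (1 + a) / 2) ∨ (f 0 = (1 + a) / 2 ∧ f 1 = (1 - a) / 2)) :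
    IsRelIntBasis (IntermediateField.adjoin ℚ S) (IntermediateField.adjoin ℚ (insert a S)) f := by
  have haL : a ∈ IntermediateField.adjoin ℚ (insert a S) :=
    IntermediateField.subset_adjoin _ _ (Set.mem_insert _ _)
  have haK := hR.sqrt_notMem hd had
  have hα : IsIntegral ℤ ((1 + a) / 2) := by
    obtain ⟨k, hk⟩ : ∃ k, d = 4 * k + 1 := ⟨d / 4, by omega⟩
    refine ⟨Polynomial.X ^ 2 - Polynomial.X - Polynomial.C k, by monicity!, ?_⟩
    rw [Polynomial.eval₂_sub, Polynomial.eval₂_sub, Polynomial.eval₂_pow, Polynomial.eval₂_X,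
      Polynomial.eval₂_C, eq_intCast]
    have : (d : ℂ) = 4 * k + 1 := by exact_mod_cast hk
    linear_combination (had + this) / 4
  have hα' : IsIntegral ℤ ((1 - a) / 2) := by
    refine isIntegral_of_eq (isIntegral_one.sub hα) ?_
    ring
  have hαL : (1 + a) / 2 ∈ IntermediateField.adjoin ℚ (insert a S) :=
    div_mem (add_mem (one_mem _) haL) (ofNat_mem _ 2)
  have hαL' : (1 - a) / 2 ∈ IntermediateField.adjoin ℚ (insert a S) :=
    div_mem (sub_mem (one_mem _) haL) (ofNat_mem _ 2)
  have hexists : ∀ x ∈ IntermediateField.adjoin ℚ (insert a S), IsIntegral ℤ x →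
      ∃ u ∈ IntermediateField.adjoin ℚ S, ∃ v ∈ IntermediateField.adjoin ℚ S,
        IsIntegral ℤ u ∧ IsIntegral ℤ v ∧ x = u + (1 + a) / 2 * v := by
    intro x hx hxi
    obtain ⟨u, hu, v, hv, rfl⟩ := exists_eq_add_mul_of_mem_adjoin_insert hS had hx
    have h2v := (hR.isIntegral_two_mul hd.ne_zero had haK hu hv hxi).2
    refine ⟨u - v, sub_mem hu hv, 2 * v, mul_mem (ofNat_mem _ 2) hv, ?_, h2v, by ring⟩
    refine isIntegral_of_eq (hxi.sub (h2v.mul hα)) ?_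
    ring
  refine ⟨IntermediateField.adjoin.mono _ _ _ (Set.subset_insert _ _), ?_, ?_, ?_, ?_⟩
  · rw [Fin.forall_fin_two]
    rcases hf with ⟨h0, h1⟩ | ⟨h0, h1⟩ <;> rw [h0, h1]
    exacts [⟨one_mem _, hαL⟩, ⟨hαL, hαL'⟩]
  · rw [Fin.forall_fin_two]
    rcases hf with ⟨h0, h1⟩ | ⟨h0, h1⟩ <;> rw [h0, h1]
    exacts [⟨isIntegral_one, hα⟩, ⟨hα, hα'⟩]
  · intro u hu v hv h
    rcases hf with ⟨h0, h1⟩ | ⟨h0, h1⟩ <;> rw [h0, h1] at h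
    · obtain ⟨h2, h3⟩ := eq_zero_of_add_mul_eq_zero haK
        (add_mem hu (div_mem hv (ofNat_mem _ 2))) (div_mem hv (ofNat_mem _ 2))
        (by linear_combination h)
      exact ⟨by linear_combination h2 - h3, by linear_combination 2 * h3⟩
    · obtain ⟨h2, h3⟩ := eq_zero_of_add_mul_eq_zero haK (add_mem hu hv) (sub_mem hu hv)
        (by linear_combination 2 * h)
      exact ⟨by linear_combination (h2 + h3) / 2, by linear_combination (h2 - h3) / 2⟩
  · intro x hx hxi
    obtain ⟨u, hu, v, hv, hui, hvi, rfl⟩ := hexists x hx hxi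
    rcases hf with ⟨h0, h1⟩ | ⟨h0, h1⟩ <;> rw [h0, h1]
    · exact ⟨u, hu, v, hv, hui, hvi, by ring⟩
    · exact ⟨u + v, add_mem hu hv, u, hu, hui.add hvi, hui, by ring⟩

/-- Products of relative integral bases along a tower of adjunctions. -/
lemma IsRelIntBasis.isIntBasis_prod {n : ℕ} {b : Fin (n + 1) → ℂ} {F : Fin (n + 1) → Fin 2 → ℂ}
    (h : IsRelIntBasis (IntermediateField.adjoin ℚ (Set.range fun i : Fin n ↦ b i.succ))
      (IntermediateField.adjoin ℚ (insert (b 0) (Set.range fun i : Fin n ↦ b i.succ))) (F 0))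
    (he : IsIntBasis (IntermediateField.adjoin ℚ (Set.range fun i : Fin n ↦ b i.succ))
      fun s : Fin n → Fin 2 ↦ ∏ i, F i.succ (s i)) :
    IsIntBasis (IntermediateField.adjoin ℚ (Set.range b))
      fun s : Fin (n + 1) → Fin 2 ↦ ∏ i, F i (s i) := by
  rw [Fin.range_eq_insert]
  convert (h.isIntBasis he).comp_equiv (Fin.consEquiv fun _ ↦ Fin 2).symm using 1
  ext s
  simp [Fin.prod_univ_succ, Fin.consEquiv, Fin.tail]

lemma isIntBasis_prod_quadratic (n : ℕ) (b : Fin (n + 1) → ℂ) (d : Fin (n + 1) → ℤ)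
    (hbd : ∀ i, b i ^ 2 = d i)
    (hinj : Function.Injective fun i : Fin n ↦ d i.castSucc)
    (hmod : ∀ i : Fin n, d i.castSucc % 4 = 1)
    (hprime : ∀ i : Fin n, Prime (d i.castSucc))
    (hlast : d (Fin.last n) = 8 ∨ d (Fin.last n) = -8)
    (F : Fin (n + 1) → Fin 2 → ℂ)
    (hF : ∀ i : Fin n,
      (F i.castSucc 0 = 1 ∧ F i.castSucc 1 = (1 + b i.castSucc) / 2) ∨
      (F i.castSucc 0 = (1 + b i.castSucc) / 2 ∧ F i.castSucc 1 = (1 - b i.castSucc) / 2))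
    (hFlast0 : F (Fin.last n) 0 = 1) (hFlast1 : F (Fin.last n) 1 = b (Fin.last n) / 2) :
    IsIntBasis (IntermediateField.adjoin ℚ (Set.range b))
      fun s : Fin (n + 1) → Fin 2 ↦ ∏ i, F i (s i) := by
  induction n with
  | zero =>
    apply IsRelIntBasis.isIntBasis_prod
    · rw [Set.range_eq_empty, IntermediateField.adjoin_empty]
      rcases hlast with h | h
      · exact isRelIntBasis_sqrt_two (Or.inl rfl) h (hbd 0) hFlast0 hFlast1
      · exact isRelIntBasis_sqrt_two (Or.inr rfl) h (hbd 0) hFlast0 hFlast1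
    · rw [Set.range_eq_empty, IntermediateField.adjoin_empty]
      simpa using isIntBasis_bot
  | succ n ih =>
    have hp : Prime (d 0) := hprime 0
    have hodd : d 0 % 4 = 1 := hmod 0
    have h2 : IsCoprime 2 (d 0) := ⟨-(d 0 / 2), 1, by omega⟩
    apply IsRelIntBasis.isIntBasis_prod
    · refine isRelIntBasis_adjoin_insert ?_ hp hodd (hbd 0) ?_ (hF 0)
      · rintro _ ⟨i, rfl⟩
        exact isIntegral_sqrt (hbd _)
      · refine sqDvdImpDvd_adjoin_range hp _ _ (fun i ↦ d i.succ) (fun i ↦ hbd _) fun i ↦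
          h2.mul_left ?_
        induction i using Fin.lastCases with
        | last =>
          have h8 : IsCoprime (8 : ℤ) (d 0) := by
            have := h2.pow_left (m := 3)
            norm_num at this
            exact this
          rcases hlast with h | h <;> rw [Fin.succ_last, h]
          · exact h8
          · exact h8.neg_left
        | cast i =>
          rw [isCoprime_comm, hp.coprime_iff_not_dvd]
          intro hdvd
          have hi := hmod i.succ
          rw [Fin.succ_castSucc] at hdvd
          have hass := (hp.dvd_prime_iff_associated (hprime i.succ)).1 hdvd
          rcases Int.associated_iff.1 hass with h | h
          · have := hinj (a₁ := 0) (a₂ := i.succ) h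
            exact (Fin.succ_ne_zero i) this.symm
          · omega
    · refine ih _ (fun i ↦ d i.succ) (fun i ↦ hbd _) ?_ (fun i ↦ hmod i.succ)
        (fun i ↦ hprime i.succ) hlast (fun i ↦ F i.succ) (fun i ↦ hF i.succ) hFlast0 hFlast1
      intro i j hij
      exact Fin.succ_injective _ (hinj (a₁ := i.succ) (a₂ := j.succ) hij)

lemma csqrt_sq (x : ℝ) : csqrt x ^ 2 = x := by
  unfold csqrt
  split_ifs with h
  · rw [mul_pow, Complex.I_sq, ← Complex.ofReal_pow, Real.sq_sqrt (by linarith)]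
    simp
  · rw [← Complex.ofReal_pow, Real.sq_sqrt (by linarith)]

lemma csqrt_div_four (x : ℝ) : csqrt (x / 4) = csqrt x / 2 := by
  have h4 : √4 = 2 := by
    rw [show (4 : ℝ) = 2 ^ 2 by norm_num, Real.sqrt_sq (by norm_num)]
  have hiff : x / 4 < 0 ↔ x < 0 := by constructor <;> intro h <;> linarith
  unfold csqrt
  simp only [hiff]
  split_ifs
  · rw [← neg_div, Real.sqrt_div' _ (by norm_num), h4]
    push_cast
    ring
  · rw [Real.sqrt_div' _ (by norm_num), h4]
    push_cast
    ring

/- Here `r = r' + 1`: the indices `1, …, r−1` correspond to `i.castSucc` for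
`i : Fin r'`, and the index `r` corresponds to `Fin.last r'`. -/
theorem stmt6 (r' : ℕ) (qt : Fin (r' + 1) → ℤ)
    (hinj : Function.Injective fun i : Fin r' => qt i.castSucc)
    (hmod : ∀ i : Fin r', qt i.castSucc % 4 = 1)
    (hoddprime : ∀ i : Fin r', Odd (qt i.castSucc).natAbs ∧ (qt i.castSucc).natAbs.Prime)
    (hlast : qt (Fin.last r') = 8 ∨ qt (Fin.last r') = -8)
    (a : Fin (r' + 1) → ℂ) (abar : Fin r' → ℂ)
    (ha : ∀ i : Fin r', a i.castSucc = (1 + csqrt (qt i.castSucc : ℝ)) / 2)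
    (habar : ∀ i : Fin r', abar i = (1 - csqrt (qt i.castSucc : ℝ)) / 2)
    (halast : a (Fin.last r') = csqrt ((qt (Fin.last r') : ℝ) / 4))
    -- `M = ℚ(√q̃_1, …, √q̃_r)` generated inside `ℂ`
    (M : IntermediateField ℚ ℂ)
    (hM : M = IntermediateField.adjoin ℚ (Set.range fun i => csqrt (qt i : ℝ)))
    (e e' : (Fin (r' + 1) → Fin 2) → ℂ)
    (he : ∀ s, e s = ∏ i, a i ^ (s i : ℕ))
    (he' : ∀ s, e' s =
      (∏ i : Fin r', abar i ^ (s i.castSucc : ℕ) * a i.castSucc ^ (1 - (s i.castSucc : ℕ))) *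
        a (Fin.last r') ^ (s (Fin.last r') : ℕ)) :
    IsIntBasis M e ∧ IsIntBasis M e' := by
  have hbd : ∀ i, csqrt (qt i : ℝ) ^ 2 = (qt i : ℤ) := fun i ↦ by simp [csqrt_sq]
  have hprime : ∀ i : Fin r', Prime (qt i.castSucc) := fun i ↦
    Int.prime_iff_natAbs_prime.2 (hoddprime i).2
  rw [csqrt_div_four] at halast
  have key := isIntBasis_prod_quadratic r' _ qt hbd hinj hmod hprime hlast
  subst hM
  constructor
  · have h := key (fun i t ↦ a i ^ (t : ℕ)) (fun i ↦ Or.inl (by simp [ha])) (by simp)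
      (by simp [halast])
    rwa [show e = fun s ↦ ∏ i, a i ^ (s i : ℕ) from funext he]
  · have h := key (fun i t ↦ Fin.lastCases (motive := fun _ ↦ ℂ) (a (Fin.last r') ^ (t : ℕ))
      (fun j ↦ abar j ^ (t : ℕ) * a j.castSucc ^ (1 - (t : ℕ))) i)
      (fun i ↦ Or.inr (by simp [ha, habar])) (by simp) (by simp [halast])
    convert h using 1
    ext s
    simp [he', Fin.prod_univ_castSucc]
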